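/- Let R be a local ring containing 1/2 (if R is not a field, assume its residue field has at least 5 elements). Then the Witt K-theory ring KW_*(R) is commutative; in particular [a]·[b] = [b]·[a] for all units a, b of R. -/

import Mathlib

/-- The defining relations of the Witt `K`-theory ring of `R`: the generator `[a]`
(for `a ∈ Rˣ`) is encoded as `some a` (in degree `1`), and the generator `η` as
`none` (in degree `-1`). -/
inductive KWRel (R : Type) [CommRing R] :
    FreeAlgebra ℤ (Option Rˣ) → FreeAlgebra ℤ (Option Rˣ) → Prop
  /-- (WK1) `η·[a] = [a]·η`. -/
  | comm (a : Rˣ) : KWRel R (FreeAlgebra.ι ℤ none * FreeAlgebra.ι ℤ (some a))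
      (FreeAlgebra.ι ℤ (some a) * FreeAlgebra.ι ℤ none)
  /-- (WK2) `[ab] = [a] + [b] - η·[a]·[b]`. -/
  | mul (a b : Rˣ) : KWRel R (FreeAlgebra.ι ℤ (some (a * b)))
      (FreeAlgebra.ι ℤ (some a) + FreeAlgebra.ι ℤ (some b) -
        FreeAlgebra.ι ℤ none * FreeAlgebra.ι ℤ (some a) * FreeAlgebra.ι ℤ (some b))
  /-- (WK3) `[a]·[1-a] = 0` for `a, 1-a ∈ Rˣ`. -/
  | steinberg (a b : Rˣ) (h : (a : R) + (b : R) = 1) :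
      KWRel R (FreeAlgebra.ι ℤ (some a) * FreeAlgebra.ι ℤ (some b)) 0
  /-- (WK4) `2 = η·[-1]`. -/
  | hyperbolic : KWRel R 2 (FreeAlgebra.ι ℤ none * FreeAlgebra.ι ℤ (some (-1)))

/-- The Witt `K`-theory ring `KW_*(R)` of `R`: the quotient of the free `ℤ`-algebra on
generators `[a]` (`a ∈ Rˣ`, degree `1`) and `η` (degree `-1`) by the two-sided ideal
generated by the relations (WK1)–(WK4). -/
def KW (R : Type) [CommRing R] := RingQuot (KWRel R)

noncomputable instance (R : Type) [CommRing R] : Ring (KW R) :=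
  inferInstanceAs (Ring (RingQuot (KWRel R)))

namespace KW

variable (R : Type) [CommRing R]

/-- The degree-one generator `[a]` of `KW_*(R)`. -/
noncomputable def gen (a : Rˣ) : KW R :=
  RingQuot.mkRingHom (KWRel R) (FreeAlgebra.ι ℤ (some a))

/-- The degree-minus-one generator `η` of `KW_*(R)`. -/
noncomputable def eta : KW R :=
  RingQuot.mkRingHom (KWRel R) (FreeAlgebra.ι ℤ none)

/-- `⟨a⟩ := 1 - η·[a]` in `KW_0(R)`. -/
noncomputable def gu (a : Rˣ) : KW R := 1 - eta R * gen R a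

end KW

namespace KW

variable {R : Type} [CommRing R]

lemma eta_mul_gen (a : Rˣ) : eta R * gen R a = gen R a * eta R := by
  have h := RingQuot.mkRingHom_rel (KWRel.comm a)
  simp only [map_mul] at h
  exact h

lemma gen_mul (a b : Rˣ) :
    gen R (a * b) = gen R a + gen R b - eta R * gen R a * gen R b := by
  have h := RingQuot.mkRingHom_rel (KWRel.mul a b)
  simp only [map_mul, map_add, map_sub] at h
  exact h

lemma gen_mul_gen_of_add_eq_one (a b : Rˣ) (h : (a : R) + (b : R) = 1) :
    gen R a * gen R b = 0 := by
  have h := RingQuot.mkRingHom_rel (KWRel.steinberg a b h)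
  simp only [map_mul, map_zero] at h
  exact h

lemma eta_mul_gen_neg_one : eta R * gen R (-1) = 2 := by
  have h := RingQuot.mkRingHom_rel (KWRel.hyperbolic (R := R))
  simp only [map_mul, map_ofNat] at h
  exact h.symm

lemma eta_mul_gen_mul_gen_comm (a b : Rˣ) :
    eta R * gen R a * gen R b = eta R * gen R b * gen R a := by
  have h := gen_mul a b
  rw [mul_comm a b, gen_mul b a,
    sub_eq_sub_iff_add_eq_add, add_comm (gen R b), add_left_cancel_iff] at h
  exact h

lemma gen_one : gen R 1 = 0 := by
  have h := gen_mul (R := R) (-1) 1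
  rw [eta_mul_gen_neg_one, mul_one, two_mul, add_sub_add_right_eq_sub, eq_sub_iff_add_eq] at h
  exact add_eq_left.1 h

lemma gen_neg (a : Rˣ) : gen R (-a) = gen R (-1) - gen R a := by
  rw [← neg_one_mul a, gen_mul, eta_mul_gen_neg_one]
  noncomm_ring

/-- If `1 - a` is a unit, then `[a]·[-a] = 0`, stated as `[a]² = [a]·[-1]`. -/
lemma gen_mul_self_of_isUnit_one_sub (a : Rˣ) (h : IsUnit (1 - (a : R))) :
    gen R a * gen R a = gen R a * gen R (-1) := by
  obtain ⟨c, hc⟩ := h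
  have hac : gen R a * gen R c = 0 := gen_mul_gen_of_add_eq_one a c (by rw [hc]; ring)
  have hd : gen R a⁻¹ * gen R (-a⁻¹ * c) = 0 :=
    gen_mul_gen_of_add_eq_one _ _ (by simp [hc, mul_sub])
  set d := -a⁻¹ * c with hd'
  have hcd : c = -a * d := by simp [hd']
  have hinv := gen_mul a a⁻¹
  rw [mul_inv_cancel, gen_one] at hinv
  have had : gen R a * gen R d = 0 := by
    have h := congrArg (· * gen R d) hinv
    simp only [sub_mul, add_mul, mul_assoc, hd, mul_zero, zero_mul, add_zero, sub_zero] at h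
    exact h.symm
  have hna : gen R a * gen R (-a) = 0 := by
    rw [hcd, gen_mul, mul_sub, mul_add, had] at hac
    have : gen R a * (eta R * gen R (-a) * gen R d) = 0 := by
      rw [← mul_assoc, ← mul_assoc, ← eta_mul_gen, eta_mul_gen_mul_gen_comm, mul_assoc, had,
        mul_zero]
    rwa [this, add_zero, sub_zero] at hac
  rw [gen_neg, mul_sub, sub_eq_zero] at hna
  exact hna.symm

/-- The failure of `[a]` and `[b]` to commute is measured by `[a]·[-1] - [a]²`. -/
lemma gen_commutator_eq (a b : Rˣ) (hb : gen R b * gen R b = gen R b * gen R (-1))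
    (hab : gen R (a * b) * gen R (a * b) = gen R (a * b) * gen R (-1)) :
    gen R b * gen R a - gen R a * gen R b = gen R a * gen R (-1) - gen R a * gen R a := by
  rw [gen_mul] at hab
  have he := eta_mul_gen_neg_one (R := R)
  have hea := eta_mul_gen a
  have heb := eta_mul_gen b
  have heab := eta_mul_gen_mul_gen_comm a b
  generalize gen R a = A, gen R b = B, gen R (-1) = M, eta R = e at *
  have h1 : e * A * B * B = 2 * (A * B) := by
    rw [hea, mul_assoc, mul_assoc, hb, ← mul_assoc e, heb, mul_assoc B, he]
    noncomm_ring
  have h2 : B * (e * A * B) = 2 * (A * B) := by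
    rw [← mul_assoc, ← mul_assoc, ← heb, ← h1, heab]
  have h3 : e * A * B * A = A * (e * A * B) := by
    rw [heab, ← mul_assoc, ← mul_assoc, ← hea, heab]
  have h4 : e * A * B * (e * A * B) = 2 * (A * (e * A * B)) := by
    rw [mul_assoc (e * A), h2, ← mul_assoc A, ← mul_assoc A, ← hea]
    noncomm_ring
  have h5 : e * A * B * M = 2 * (A * B) := by
    rw [← h1, mul_assoc, ← hb, ← mul_assoc]
  generalize e * A * B = T at *
  simp only [sub_mul, add_mul, mul_sub, mul_add, h1, h2, h3, h4, h5, hb] at hab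
  rw [← sub_eq_zero] at hab ⊢
  rw [← hab]
  noncomm_ring

/-- The commutator with `[a]` is additive along products. -/
lemma gen_commutator_mul (a b c : Rˣ) :
    gen R (b * c) * gen R a - gen R a * gen R (b * c) =
      (gen R b * gen R a - gen R a * gen R b) + (gen R c * gen R a - gen R a * gen R c) := by
  have h : eta R * gen R b * gen R c * gen R a = gen R a * (eta R * gen R b * gen R c) := by
    rw [← mul_assoc, ← mul_assoc, ← eta_mul_gen, eta_mul_gen_mul_gen_comm a b, eta_mul_gen b]
    simp only [mul_assoc]
    rw [← mul_assoc (eta R), ← mul_assoc (eta R), eta_mul_gen_mul_gen_comm]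
  rw [gen_mul, sub_mul, add_mul, mul_sub, mul_add, h]
  abel

open IsLocalRing in
lemma exists_unit_sq_sub_one [IsLocalRing R] (h : 5 ≤ Cardinal.mk (ResidueField R)) :
    ∃ b : Rˣ, IsUnit (1 - (b : R)) ∧ IsUnit (1 - ((b * b : Rˣ) : R)) := by
  classical
  obtain ⟨x, hx⟩ : ∃ x : ResidueField R, x ∉ ({0, 1, -1} : Finset (ResidueField R)) := by
    by_contra! hall
    have hle : Cardinal.mk (ResidueField R) ≤ 3 := by
      rw [← Cardinal.mk_univ, show Set.univ = (({0, 1, -1} : Finset (ResidueField R)) : Set _) from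
        (Set.eq_univ_of_forall hall).symm]
      refine Cardinal.mk_coe_finset.trans_le ?_
      exact_mod_cast Finset.card_le_three
    have := h.trans hle
    norm_num at this
  simp only [Finset.mem_insert, Finset.mem_singleton, not_or] at hx
  obtain ⟨y, rfl⟩ := residue_surjective x
  have key (z : R) (hz : residue R z ≠ 0) : IsUnit z := by
    simpa using (residue_ne_zero_iff_isUnit z).1 hz
  obtain ⟨b, rfl⟩ := key y hx.1
  have h1 : IsUnit (1 - (b : R)) :=
    key _ (by rw [map_sub, map_one, sub_ne_zero]; exact Ne.symm hx.2.1)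
  have h2 : IsUnit (1 + (b : R)) :=
    key _ (by rw [map_add, map_one]; exact fun h ↦ hx.2.2 (eq_neg_of_add_eq_zero_right h))
  refine ⟨b, h1, ?_⟩
  convert h1.mul h2 using 1
  push_cast
  ring

open IsLocalRing in
lemma gen_mul_self [IsLocalRing R] (hR : IsField R ∨ 5 ≤ Cardinal.mk (ResidueField R)) (a : Rˣ) :
    gen R a * gen R a = gen R a * gen R (-1) := by
  by_cases ha : IsUnit (1 - (a : R))
  · exact gen_mul_self_of_isUnit_one_sub a ha
  rcases hR with hR | hR
  · have h0 : 1 - (a : R) = 0 := by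
      by_contra hne
      obtain ⟨c, hc⟩ := hR.mul_inv_cancel hne
      exact ha (.of_mul_eq_one c hc)
    obtain rfl : a = 1 := by
      ext
      simpa using (sub_eq_zero.1 h0).symm
    simp [gen_one]
  · obtain ⟨b, hb, hbb⟩ := exists_unit_sq_sub_one hR
    have key (c : Rˣ) (hc : IsUnit (1 - (c : R))) :
        gen R c * gen R a - gen R a * gen R c = gen R a * gen R (-1) - gen R a * gen R a := by
      refine gen_commutator_eq a c (gen_mul_self_of_isUnit_one_sub c hc)
        (gen_mul_self_of_isUnit_one_sub _ ?_)
      have hsum : IsUnit ((1 - ((a * c : Rˣ) : R)) + -(c * (1 - (a : R)))) := by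
        convert hc using 1
        push_cast
        ring
      refine (isUnit_or_isUnit_of_isUnit_add hsum).resolve_right fun hu ↦ ha ?_
      exact isUnit_of_mul_isUnit_right (IsUnit.neg_iff _ |>.1 hu)
    have h := gen_commutator_mul a b b
    rw [key _ hb, key _ hbb] at h
    exact (sub_eq_zero.1 (left_eq_add.1 h)).symm

open IsLocalRing in
lemma gen_mul_gen_comm [IsLocalRing R] (hR : IsField R ∨ 5 ≤ Cardinal.mk (ResidueField R))
    (a b : Rˣ) : gen R a * gen R b = gen R b * gen R a := by
  have h := gen_commutator_eq a b (gen_mul_self hR b) (gen_mul_self hR _)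
  rw [gen_mul_self hR a, sub_self, sub_eq_zero] at h
  exact h.symm

/-- A subring of `KW R` containing `η` and all the `[a]` is everything. -/
lemma mem_of_generators (S : Subring (KW R)) (heta : eta R ∈ S) (hgen : ∀ a, gen R a ∈ S)
    (x : KW R) : x ∈ S := by
  obtain ⟨y, rfl⟩ := RingQuot.mkRingHom_surjective (KWRel R) x
  induction y using FreeAlgebra.induction with
  | grade0 r =>
    rw [eq_intCast (algebraMap ℤ (FreeAlgebra ℤ (Option Rˣ))), map_intCast]
    exact intCast_mem S r
  | grade1 o =>
    cases o with
    | none => exact heta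
    | some a => exact hgen a
  | mul a b ha hb => rw [map_mul]; exact S.mul_mem ha hb
  | add a b ha hb => rw [map_add]; exact S.add_mem ha hb

end KW

open IsLocalRing in
/-- **Statement 10.** Let `R` be a local ring containing `1/2` (if `R` is not a field its
residue field has at least 5 elements).  Then the Witt `K`-theory ring `KW_*(R)` is
commutative; in particular `[a]·[b] = [b]·[a]` for all units `a, b` of `R`. -/
theorem statement10 (R : Type) [CommRing R] [IsLocalRing R] [Invertible (2 : R)]
    (hR : IsField R ∨ 5 ≤ Cardinal.mk (ResidueField R)) :
    (∀ x y : KW R, x * y = y * x) ∧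
    (∀ a b : Rˣ, KW.gen R a * KW.gen R b = KW.gen R b * KW.gen R a) := by
  have hgen := KW.gen_mul_gen_comm hR
  have heta (x : KW R) : x * KW.eta R = KW.eta R * x :=
    Subring.mem_centralizer_iff.1 (KW.mem_of_generators (Subring.centralizer {KW.eta R})
      (by simp [Subring.mem_centralizer_iff])
      (by simp [Subring.mem_centralizer_iff, KW.eta_mul_gen]) x) _ rfl |>.symm
  have hcenter (a : Rˣ) (x : KW R) : x * KW.gen R a = KW.gen R a * x :=
    Subring.mem_centralizer_iff.1 (KW.mem_of_generators (Subring.centralizer {KW.gen R a})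
      (by simp [Subring.mem_centralizer_iff, KW.eta_mul_gen])
      (by simp [Subring.mem_centralizer_iff, hgen a]) x) _ rfl |>.symm
  refine ⟨fun x y ↦ ?_, hgen⟩
  exact Subring.mem_center_iff.1 (KW.mem_of_generators (Subring.center (KW R))
    (Subring.mem_center_iff.2 heta) (fun a ↦ Subring.mem_center_iff.2 (hcenter a)) y) x
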